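/- The conditional law of a spectrally negative stable process given positivity is Mittag-Leffler: Let 1 < α ≤ 2, γ = 1/α, b > 0, and let P(x,t) = p_α(x; 2−α, b^{−α} t). Then for all t > 0 and all z ≥ 0, ∫_0^∞ e^{−zx} P(x,t) dx = γ · E_γ(−z b^{−1} t^γ), where E_γ is the Mittag-Leffler function. -/

import Mathlib

open MeasureTheory Real Set

/-- Zolotarev's parametrization of the stable density: the real-valued inverse Fourier
integral `p_α(x; η, b) = (1/(2π)) ∫ e^{-iλx} exp(-b|λ|^α e^{-iπη·sgn(λ)/2}) dλ`. -/
noncomputable def zolDensity (α η b x : ℝ) : ℝ :=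
  (1 / (2 * Real.pi)) *
    (∫ l : ℝ, Complex.exp (-Complex.I * (l : ℂ) * (x : ℂ)) *
        Complex.exp (-(b : ℂ) * ((|l| ^ α : ℝ) : ℂ) *
          Complex.exp (-Complex.I * (Real.pi : ℂ) * (η : ℂ) * ((Real.sign l : ℝ) : ℂ) / 2))).re

/-- The Mittag-Leffler function `E_β(z) = Σ_{k=0}^∞ z^k / Γ(1 + βk)`. -/
noncomputable def mittagLeffler (β z : ℝ) : ℝ := ∑' k : ℕ, z ^ k / Real.Gamma (1 + β * k)

lemma aux_int_gamma {a r : ℝ} (ha : 0 < a) (hr : 0 < r) :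
    IntegrableOn (fun x : ℝ => x ^ (a - 1) * Real.exp (-r * x)) (Ioi 0) := by
  have := integrableOn_rpow_mul_exp_neg_mul_rpow (p := 1) (s := a - 1) (b := r) (by linarith)
    one_pos hr
  simpa using this

lemma aux_norm (a : ℝ) (r : ℂ) {x : ℝ} (hx : 0 < x) :
    ‖(x : ℂ) ^ ((a : ℂ) - 1) * Complex.exp (-(r * x))‖ = x ^ (a - 1) * Real.exp (-r.re * x) := by
  rw [norm_mul, Complex.norm_cpow_eq_rpow_re_of_pos hx, Complex.norm_exp]
  simp

lemma aux_meas (a : ℝ) (r : ℂ) :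
    AEStronglyMeasurable (fun x : ℝ => (x : ℂ) ^ ((a : ℂ) - 1) * Complex.exp (-(r * x)))
      (volume.restrict (Ioi 0)) := by
  refine ContinuousOn.aestronglyMeasurable ?_ measurableSet_Ioi
  refine ContinuousOn.mul ?_ (by fun_prop)
  intro x hx
  refine ContinuousAt.continuousWithinAt ?_
  exact (continuousAt_cpow_const (Complex.ofReal_mem_slitPlane.2 hx)).comp
    Complex.continuous_ofReal.continuousAt

lemma gammaC {a : ℝ} {r : ℂ} (ha : 0 < a) (hr : 0 < r.re) :
    ∫ x in Ioi (0 : ℝ), (x : ℂ) ^ ((a : ℂ) - 1) * Complex.exp (-(r * x))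
      = (1 / r) ^ (a : ℂ) * Complex.Gamma a := by
  have hU : IsOpen {z : ℂ | 0 < z.re} := isOpen_lt continuous_const Complex.continuous_re
  have hd1 : DifferentiableOn ℂ (fun r : ℂ => ∫ x in Ioi (0 : ℝ),
      (x : ℂ) ^ ((a : ℂ) - 1) * Complex.exp (-(r * x))) {z : ℂ | 0 < z.re} := by
    intro w hw
    have hw' : 0 < w.re := hw
    refine DifferentiableAt.differentiableWithinAt ?_
    refine (hasDerivAt_integral_of_dominated_loc_of_deriv_le
      (F := fun (r : ℂ) (x : ℝ) => (x : ℂ) ^ ((a : ℂ) - 1) * Complex.exp (-(r * x)))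
      (F' := fun (r : ℂ) (x : ℝ) =>
        (x : ℂ) ^ ((a : ℂ) - 1) * (Complex.exp (-(r * x)) * (-x)))
      (bound := fun x => x ^ ((a + 1) - 1) * Real.exp (-(w.re / 2) * x))
      (s := {z : ℂ | w.re / 2 < z.re}) ?_ ?_ ?_ ?_ ?_ ?_ ?_).2.differentiableAt
    · exact (isOpen_lt continuous_const Complex.continuous_re).mem_nhds (by
        simp only [mem_ofPred_eq]; linarith)
    · exact Filter.Eventually.of_forall fun r => aux_meas a r
    · refine Integrable.mono' (aux_int_gamma ha hw') (aux_meas a w) ?_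
      filter_upwards [ae_restrict_mem measurableSet_Ioi] with x hx
      rw [aux_norm a w hx]
    · have := (aux_meas a w).mul
        (Continuous.aestronglyMeasurable (f := fun x : ℝ => (-x : ℂ)) (by fun_prop))
      refine this.congr (Filter.Eventually.of_forall fun x => ?_)
      simp [mul_assoc]
    · filter_upwards [ae_restrict_mem measurableSet_Ioi] with x hx z hz
      have hx' : 0 < x := hx
      rw [← mul_assoc, norm_mul, aux_norm a z hx]
      have : ‖(-x : ℂ)‖ = x := by simp [abs_of_pos hx']
      rw [this, add_sub_cancel_right]
      have h1 : x ^ a = x ^ (a - 1) * x := by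
        rw [Real.rpow_sub_one hx'.ne']; field_simp
      rw [h1]
      have h2 : Real.exp (-z.re * x) ≤ Real.exp (-(w.re / 2) * x) := by
        apply Real.exp_le_exp.2
        have hz' : w.re / 2 < z.re := hz
        nlinarith
      have : 0 < x ^ (a - 1) := Real.rpow_pos_of_pos hx' _
      calc x ^ (a - 1) * Real.exp (-z.re * x) * x
          = x ^ (a - 1) * x * Real.exp (-z.re * x) := by ring
        _ ≤ _ := by gcongr
    · exact aux_int_gamma (by linarith) (by linarith)
    · refine Filter.Eventually.of_forall fun x z hz => ?_
      have h1 : HasDerivAt (fun z : ℂ => -(z * x)) (-x : ℂ) z := by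
        have h0 := ((hasDerivAt_id z).mul_const (x : ℂ)).neg
        rw [one_mul] at h0
        exact h0
      exact h1.cexp.const_mul _
  have hd2 : DifferentiableOn ℂ (fun r : ℂ => (1 / r) ^ (a : ℂ) * Complex.Gamma a)
      {z : ℂ | 0 < z.re} := by
    intro w hw
    have hw' : 0 < w.re := hw
    have hw0 : w ≠ 0 := by rintro rfl; simp at hw'
    refine DifferentiableAt.differentiableWithinAt ?_
    refine DifferentiableAt.mul_const ?_ _
    refine DifferentiableAt.cpow_const ?_ ?_
    · exact (differentiableAt_const _).div differentiableAt_id hw0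
    · left
      simp only [one_div, Complex.inv_re]
      have := Complex.normSq_pos.2 hw0
      positivity
  have h := (hd1.analyticOnNhd hU).eqOn_of_preconnected_of_frequently_eq
    (hd2.analyticOnNhd hU) (z₀ := 1)
    (convex_halfSpace_re_gt 0).isPreconnected (by simp) ?_
  · exact h hr
  · have ht : Filter.Tendsto (fun x : ℝ => (x : ℂ)) (nhdsWithin 1 {1}ᶜ) (nhdsWithin 1 {1}ᶜ) := by
      refine tendsto_nhdsWithin_iff.2 ⟨?_, ?_⟩
      · exact (Complex.continuous_ofReal.tendsto' 1 1 (by simp)).mono_left nhdsWithin_le_nhds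
      · filter_upwards [self_mem_nhdsWithin] with x hx
        simpa using hx
    refine ht.frequently ?_
    refine Filter.Eventually.frequently ?_
    have : ∀ᶠ x : ℝ in nhdsWithin 1 {1}ᶜ, 0 < x :=
      nhdsWithin_le_nhds (lt_mem_nhds one_pos)
    filter_upwards [this] with x hx
    exact Complex.integral_cpow_mul_exp_neg_mul_Ioi (by simpa using ha) hx

lemma pos_mul_cpow {l : ℝ} (hl : 0 < l) {w : ℂ} (hw : w ≠ 0) (α : ℝ) :
    ((l : ℂ) * w) ^ (α : ℂ) = ((l ^ α : ℝ) : ℂ) * w ^ (α : ℂ) := by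
  have hl' : (l : ℂ) ≠ 0 := by exact_mod_cast hl.ne'
  rw [Complex.cpow_def_of_ne_zero (mul_ne_zero hl' hw), Complex.log_ofReal_mul hl hw, add_mul,
    Complex.exp_add, ← Complex.cpow_def_of_ne_zero hw, Real.rpow_def_of_pos hl]
  push_cast
  rfl

lemma I_cpow (α : ℝ) : Complex.I ^ (α : ℂ) = Complex.exp (((π * α / 2 : ℝ) : ℂ) * Complex.I) := by
  rw [Complex.cpow_def_of_ne_zero Complex.I_ne_zero, Complex.log_I]
  push_cast; ring_nf

lemma negI_cpow (α : ℝ) :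
    (-Complex.I) ^ (α : ℂ) = Complex.exp (((-(π * α / 2) : ℝ) : ℂ) * Complex.I) := by
  rw [Complex.cpow_def_of_ne_zero (neg_ne_zero.2 Complex.I_ne_zero), Complex.log_neg_I]
  push_cast; ring_nf

lemma cos_neg_aux {α : ℝ} (h1 : 1 < α) (h2 : α ≤ 2) : Real.cos (π * α / 2) < 0 := by
  apply Real.cos_neg_of_pi_div_two_lt_of_lt <;> nlinarith [Real.pi_pos]

lemma re_bound {α : ℝ} (h1 : 1 < α) (h2 : α ≤ 2) :
    ∃ κ > 0, ∃ δ > 0, ∀ c l : ℝ, 0 ≤ c → c ≤ δ * |l| →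
      (((c : ℂ) + (l : ℂ) * Complex.I) ^ (α : ℂ)).re ≤ -κ * |l| ^ α := by
  have hcos := cos_neg_aux h1 h2
  set κ := -Real.cos (π * α / 2) / 2 with hκ
  have key : ∀ w : ℂ, w.im ≠ 0 → (w ^ (α : ℂ)).re < -κ →
      ∀ᶠ u : ℝ in nhds 0, (((u : ℂ) + w) ^ (α : ℂ)).re < -κ := by
    intro w hw hlt
    have hc : ContinuousAt (fun u : ℝ => (((u : ℂ) + w) ^ (α : ℂ)).re) 0 := by
      refine Complex.continuous_re.continuousAt.comp ?_
      refine ContinuousAt.cpow (by fun_prop) continuousAt_const ?_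
      right; simpa using hw
    refine hc.eventually_lt_const ?_
    simpa using hlt
  have e1 := key Complex.I (by simp) (by
    rw [I_cpow, Complex.exp_ofReal_mul_I_re]; linarith)
  have e2 := key (-Complex.I) (by simp) (by
    rw [negI_cpow, Complex.exp_ofReal_mul_I_re, Real.cos_neg]; linarith)
  obtain ⟨δ, hδ, H⟩ := Metric.eventually_nhds_iff.1 (e1.and e2)
  refine ⟨κ, by linarith, δ / 2, by linarith, ?_⟩
  intro c l hc hcl
  rcases lt_trichotomy l 0 with hl | hl | hl
  · have hl' : 0 < -l := by linarith
    rw [abs_of_neg hl] at hcl ⊢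
    have hne : (l : ℂ) ≠ 0 := by exact_mod_cast hl.ne
    have e : (c : ℂ) + (l : ℂ) * Complex.I
        = ((-l : ℝ) : ℂ) * (((c / (-l) : ℝ) : ℂ) + -Complex.I) := by
      push_cast; field_simp; ring
    have hw : (((c / (-l) : ℝ) : ℂ) + -Complex.I) ≠ 0 := fun h => by
      have h' := congrArg Complex.im h
      rw [Complex.add_im, Complex.ofReal_im] at h'
      simp at h'
    rw [e, pos_mul_cpow hl' hw, Complex.re_ofReal_mul]
    have hd : c / (-l) ≤ δ / 2 := by rw [div_le_iff₀ hl']; exact hcl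
    have h0 : 0 ≤ c / (-l) := by positivity
    have := (@H (c / (-l)) (by rw [Real.dist_eq, sub_zero, abs_of_nonneg h0]; linarith)).2
    have hp : 0 < (-l) ^ α := Real.rpow_pos_of_pos hl' _
    nlinarith
  · subst hl
    have : c = 0 := by simp at hcl; linarith
    subst this
    have hα : α ≠ 0 := by linarith
    simp [Real.zero_rpow hα, hα]
  · rw [abs_of_pos hl] at hcl ⊢
    have hne : (l : ℂ) ≠ 0 := by exact_mod_cast hl.ne'
    have e : (c : ℂ) + (l : ℂ) * Complex.I
        = (l : ℂ) * (((c / l : ℝ) : ℂ) + Complex.I) := by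
      push_cast; field_simp
    have hw : (((c / l : ℝ) : ℂ) + Complex.I) ≠ 0 := fun h => by
      have h' := congrArg Complex.im h
      rw [Complex.add_im, Complex.ofReal_im] at h'
      simp at h'
    rw [e, pos_mul_cpow hl hw, Complex.re_ofReal_mul]
    have hd : c / l ≤ δ / 2 := by rw [div_le_iff₀ hl]; exact hcl
    have h0 : 0 ≤ c / l := by positivity
    have := (@H (c / l) (by rw [Real.dist_eq, sub_zero, abs_of_nonneg h0]; linarith)).1
    have hp : 0 < l ^ α := Real.rpow_pos_of_pos hl _
    nlinarith

/-- The boundary function `exp (B s ^ α)`. -/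
noncomputable def gfun (α B : ℝ) (s : ℂ) : ℂ := Complex.exp (B * s ^ (α : ℂ))

lemma gfun_contAt {α B : ℝ} (h1 : 1 < α) {s : ℂ} (hs : 0 ≤ s.re) :
    ContinuousAt (gfun α B) s := by
  unfold gfun
  refine Complex.continuous_exp.continuousAt.comp ?_
  refine ContinuousAt.mul continuousAt_const ?_
  have h := Complex.continuousAt_cpow_const_of_re_pos (z := s) (w := (α : ℂ)) (Or.inl hs)
    (by simp; linarith)
  exact h

lemma gfun_line_cont {α B : ℝ} (h1 : 1 < α) {c : ℝ} (hc : 0 ≤ c) :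
    Continuous (fun l : ℝ => gfun α B ((c : ℂ) + (l : ℂ) * Complex.I)) := by
  rw [continuous_iff_continuousAt]
  intro l
  exact ContinuousAt.comp (f := fun l : ℝ => (c : ℂ) + (l : ℂ) * Complex.I)
    (gfun_contAt h1 (by simpa using hc)) (by fun_prop)

lemma gfun_norm {α B : ℝ} (s : ℂ) : ‖gfun α B s‖ = Real.exp (B * (s ^ (α : ℂ)).re) := by
  rw [gfun, Complex.norm_exp, Complex.re_ofReal_mul]

/-- Uniform decay. -/
lemma gfun_decay {α B : ℝ} (h1 : 1 < α) (h2 : α ≤ 2) (hB : 0 < B) :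
    ∃ m > 0, ∃ δ > 0, ∀ c l : ℝ, 0 ≤ c → c ≤ δ * |l| →
      ‖gfun α B ((c : ℂ) + (l : ℂ) * Complex.I)‖ ≤ Real.exp (-m * |l| ^ α) := by
  obtain ⟨κ, hκ, δ, hδ, H⟩ := re_bound h1 h2
  refine ⟨B * κ, by positivity, δ, hδ, fun c l hc hcl => ?_⟩
  rw [gfun_norm]
  apply Real.exp_le_exp.2
  have := mul_le_mul_of_nonneg_left (H c l hc hcl) hB.le
  linarith

lemma integrable_abs_rpow_exp {α m a : ℝ} (ha : -1 < a) (h1 : 1 < α) (hm : 0 < m) :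
    Integrable (fun l : ℝ => |l| ^ a * Real.exp (-m * |l| ^ α)) := by
  have := integrableOn_rpow_mul_exp_neg_mul_rpow (p := α) ha (by linarith) hm
  have hpos : IntegrableOn (fun l : ℝ => |l| ^ a * Real.exp (-m * |l| ^ α)) (Ioi 0) :=
    this.congr_fun (fun x hx => by
      have hx' : 0 < x := hx
      simp only [abs_of_pos hx']) measurableSet_Ioi
  rw [← integrableOn_univ, ← @Iio_union_Ici _ _ (0 : ℝ), integrableOn_union,
    integrableOn_Ici_iff_integrableOn_Ioi]
  refine ⟨?_, hpos⟩
  rw [← (Measure.measurePreserving_neg (volume : Measure ℝ)).integrableOn_comp_preimage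
      (Homeomorph.neg ℝ).measurableEmbedding]
  simpa only [Function.comp_def, abs_neg, neg_preimage, neg_Iio, neg_zero] using hpos

lemma gfun_integrable {α B : ℝ} (h1 : 1 < α) (h2 : α ≤ 2) (hB : 0 < B) {c : ℝ} (hc : 0 ≤ c) :
    Integrable (fun l : ℝ => gfun α B ((c : ℂ) + (l : ℂ) * Complex.I)) := by
  obtain ⟨m, hm, δ, hδ, H⟩ := gfun_decay h1 h2 hB
  have hi : Integrable (fun l : ℝ => Real.exp (-m * |l| ^ α)) := by
    simpa using integrable_abs_rpow_exp (a := 0) (by norm_num) h1 hm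
  refine (gfun_line_cont h1 hc).locallyIntegrable.integrable_of_isBigO_cocompact
    (g := fun l : ℝ => Real.exp (-m * |l| ^ α)) ?_ (hi.integrableAtFilter _)
  refine Asymptotics.IsBigO.of_bound 1 ?_
  have : ∀ᶠ l : ℝ in Filter.cocompact ℝ, c / δ ≤ ‖l‖ :=
    (tendsto_norm_cocompact_atTop (E := ℝ)).eventually_ge_atTop _
  filter_upwards [this] with l hl
  rw [Real.norm_of_nonneg (Real.exp_pos _).le, one_mul]
  refine H c l hc ?_
  rw [div_le_iff₀ hδ] at hl
  rw [mul_comm]; exact hl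

/-- The (unnormalised, complex) inverse Fourier integral. -/
noncomputable def Qf (α B x : ℝ) : ℂ :=
  ∫ l : ℝ, Complex.exp (-(((l : ℂ) * Complex.I) * x)) * gfun α B ((l : ℂ) * Complex.I)

lemma exp_line_norm (c l x : ℝ) :
    ‖Complex.exp (-(((c : ℂ) + (l : ℂ) * Complex.I) * x))‖ = Real.exp (-(c * x)) := by
  rw [Complex.norm_exp]; simp

lemma Qint {α B : ℝ} (h1 : 1 < α) (h2 : α ≤ 2) (hB : 0 < B) {c : ℝ} (hc : 0 ≤ c) (x : ℝ) :
    Integrable (fun l : ℝ => Complex.exp (-(((c : ℂ) + (l : ℂ) * Complex.I) * x)) *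
      gfun α B ((c : ℂ) + (l : ℂ) * Complex.I)) := by
  refine (gfun_integrable h1 h2 hB hc).bdd_mul (c := Real.exp (-(c * x))) ?_ ?_
  · exact Continuous.aestronglyMeasurable (by fun_prop)
  · exact Filter.Eventually.of_forall fun l => (exp_line_norm c l x).le

lemma Qf_shift {α B : ℝ} (h1 : 1 < α) (h2 : α ≤ 2) (hB : 0 < B) {c x : ℝ} (hc : 0 ≤ c)
    (hx : 0 ≤ x) :
    Qf α B x = ∫ l : ℝ, Complex.exp (-(((c : ℂ) + (l : ℂ) * Complex.I) * x)) *
      gfun α B ((c : ℂ) + (l : ℂ) * Complex.I) := by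
  set F : ℂ → ℂ := fun s => Complex.exp (-(s * x)) * gfun α B s with hF
  obtain ⟨m, hm, δ, hδ, H⟩ := gfun_decay h1 h2 hB
  have hFc : ∀ s : ℂ, 0 ≤ s.re → ContinuousAt F s := fun s hs => by
    refine ContinuousAt.mul (by fun_prop) (gfun_contAt h1 hs)
  have hFd : ∀ s : ℂ, 0 < s.re → DifferentiableAt ℂ F s := fun s hs => by
    refine DifferentiableAt.mul (by fun_prop) ?_
    unfold gfun
    refine DifferentiableAt.cexp ?_
    refine DifferentiableAt.const_mul ?_ _
    exact DifferentiableAt.cpow_const differentiableAt_id (Or.inl hs)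
  have hrect : ∀ T : ℝ, 0 ≤ T →
      ((∫ u : ℝ in (0 : ℝ)..c, F (u + ((-T : ℝ) : ℂ) * Complex.I))
        - ∫ u : ℝ in (0 : ℝ)..c, F (u + (T : ℂ) * Complex.I))
      + Complex.I • (∫ y : ℝ in (-T)..T, F (c + y * Complex.I))
      - Complex.I • (∫ y : ℝ in (-T)..T, F (((0 : ℝ) : ℂ) + y * Complex.I)) = 0 := by
    intro T hT
    have := Complex.integral_boundary_rect_eq_zero_of_continuousOn_of_differentiableOn F
      (⟨0, -T⟩ : ℂ) (⟨c, T⟩ : ℂ) ?_ ?_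
    · exact this
    · intro s hs
      refine (hFc s ?_).continuousWithinAt
      have := hs.1
      simp only [mem_preimage, uIcc_of_le hc] at this
      exact this.1
    · intro s hs
      refine (hFd s ?_).differentiableWithinAt
      have := hs.1
      simp only [mem_preimage, min_eq_left hc] at this
      exact this.1
  have hlim : ∀ c' : ℝ, 0 ≤ c' → Filter.Tendsto
      (fun T : ℝ => ∫ y : ℝ in (-T)..T, F (c' + y * Complex.I)) Filter.atTop
      (nhds (∫ y : ℝ, F (c' + y * Complex.I))) := fun c' hc' =>
    intervalIntegral_tendsto_integral (Qint h1 h2 hB hc' x) Filter.tendsto_neg_atTop_atBot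
      Filter.tendsto_id
  have hbd : ∀ T : ℝ, c / δ ≤ |T| →
      ‖∫ u : ℝ in (0 : ℝ)..c, F (u + (T : ℂ) * Complex.I)‖ ≤ Real.exp (-m * |T| ^ α) * |c - 0| := by
    intro T hT
    refine intervalIntegral.norm_integral_le_of_norm_le_const fun u hu => ?_
    rw [uIoc_of_le hc] at hu
    have hu0 : 0 ≤ u := hu.1.le
    rw [hF]
    simp only [norm_mul]
    rw [exp_line_norm]
    have e1 : Real.exp (-(u * x)) ≤ 1 := Real.exp_le_one_iff.2 (by nlinarith)
    have e2 := H u T hu0 (by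
      rw [div_le_iff₀ hδ] at hT
      linarith [hu.2])
    calc _ ≤ 1 * Real.exp (-m * |T| ^ α) := by gcongr
      _ = _ := one_mul _
  have hexp : Filter.Tendsto (fun T : ℝ => Real.exp (-m * |T| ^ α) * |c - 0|) Filter.atTop
      (nhds 0) := by
    have h0 : Filter.Tendsto (fun T : ℝ => Real.exp (-m * |T| ^ α)) Filter.atTop (nhds 0) := ?_
    · simpa using h0.mul_const |c - 0|
    refine Real.tendsto_exp_atBot.comp ?_
    refine Filter.Tendsto.const_mul_atTop_of_neg (by linarith) ?_
    exact (tendsto_rpow_atTop (by linarith)).comp Filter.tendsto_abs_atTop_atTop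
  have hz1 : Filter.Tendsto (fun T : ℝ => ∫ u : ℝ in (0 : ℝ)..c, F (u + (T : ℂ) * Complex.I))
      Filter.atTop (nhds 0) := by
    refine squeeze_zero_norm' ?_ hexp
    filter_upwards [Filter.tendsto_abs_atTop_atTop.eventually_ge_atTop (c / δ)] with T hT
    exact hbd T hT
  have hz2 : Filter.Tendsto
      (fun T : ℝ => ∫ u : ℝ in (0 : ℝ)..c, F (u + ((-T : ℝ) : ℂ) * Complex.I))
      Filter.atTop (nhds 0) := by
    refine squeeze_zero_norm' ?_ hexp
    filter_upwards [Filter.tendsto_abs_atTop_atTop.eventually_ge_atTop (c / δ)] with T hT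
    have := hbd (-T) (by rwa [abs_neg])
    rwa [abs_neg] at this
  have hall := ((hz2.sub hz1).add ((hlim c hc).const_smul Complex.I)).sub
    ((hlim 0 le_rfl).const_smul Complex.I)
  have h0 : Filter.Tendsto (fun _ : ℝ => (0 : ℂ)) Filter.atTop (nhds 0) := tendsto_const_nhds
  have heq := tendsto_nhds_unique (hall.congr' (by
    filter_upwards [Filter.eventually_ge_atTop 0] with T hT
    exact hrect T hT)) h0
  have hI : Complex.I * ((∫ y : ℝ, F (c + y * Complex.I)) -
      ∫ y : ℝ, F (((0 : ℝ) : ℂ) + y * Complex.I)) = 0 := by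
    rw [← heq]; simp only [smul_eq_mul]; ring
  rcases mul_eq_zero.1 hI with h | h
  · exact absurd h Complex.I_ne_zero
  · have h' := sub_eq_zero.1 h
    rw [Complex.ofReal_zero] at h'
    simp only [zero_add] at h'
    exact h'.symm

lemma Qf_bound {α B : ℝ} (h1 : 1 < α) (h2 : α ≤ 2) (hB : 0 < B) {c : ℝ} (hc : 0 ≤ c) :
    ∃ C, 0 ≤ C ∧ ∀ x : ℝ, 0 ≤ x → ‖Qf α B x‖ ≤ C * Real.exp (-(c * x)) := by
  refine ⟨∫ l : ℝ, ‖gfun α B ((c : ℂ) + (l : ℂ) * Complex.I)‖,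
    integral_nonneg fun _ => norm_nonneg _, fun x hx => ?_⟩
  rw [Qf_shift h1 h2 hB hc hx, ← integral_mul_const]
  refine (norm_integral_le_integral_norm _).trans (le_of_eq ?_)
  congr 1
  ext l
  rw [norm_mul, exp_line_norm, mul_comm]

lemma Qf_cont {α B : ℝ} (h1 : 1 < α) (h2 : α ≤ 2) (hB : 0 < B) : Continuous (Qf α B) := by
  have hi := gfun_integrable h1 h2 hB (c := 0) le_rfl
  rw [Complex.ofReal_zero] at hi
  simp only [zero_add] at hi
  unfold Qf
  refine continuous_of_dominated
    (bound := fun l : ℝ => ‖gfun α B ((l : ℂ) * Complex.I)‖) ?_ ?_ hi.norm ?_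
  · intro x
    refine AEStronglyMeasurable.mul ?_ hi.aestronglyMeasurable
    exact Continuous.aestronglyMeasurable (by fun_prop)
  · intro x
    refine Filter.Eventually.of_forall fun l => ?_
    have := exp_line_norm 0 l x
    rw [Complex.ofReal_zero, zero_add] at this
    rw [norm_mul, this]; simp
  · refine Filter.Eventually.of_forall fun l => ?_
    fun_prop

lemma rpow_exp_integral {α a : ℝ} {w : ℂ} (hα : 0 < α) (ha : a < 1) (hw : 0 < w.re) :
    ∫ l in Ioi (0 : ℝ), ((l ^ (-a) : ℝ) : ℂ) * Complex.exp (-(w * ((l ^ α : ℝ) : ℂ)))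
      = (1 / α : ℝ) * ((1 / w) ^ (((1 - a) / α : ℝ) : ℂ) *
          Complex.Gamma (((1 - a) / α : ℝ) : ℂ)) := by
  have hδ : 0 < (1 - a) / α := div_pos (by linarith) hα
  rw [← gammaC hδ hw, ← integral_comp_rpow_Ioi_of_pos (g := fun x : ℝ =>
    (x : ℂ) ^ ((((1 - a) / α : ℝ) : ℂ) - 1) * Complex.exp (-(w * x))) hα, ← integral_const_mul]
  refine setIntegral_congr_fun measurableSet_Ioi fun l hl => ?_
  have hl' : 0 < l := hl
  have hp : 0 < l ^ α := Real.rpow_pos_of_pos hl' _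
  simp only [Complex.real_smul]
  have e : (((l ^ α : ℝ) : ℂ)) ^ ((((1 - a) / α : ℝ) : ℂ) - 1)
      = (((l ^ (1 - a - α)) : ℝ) : ℂ) := by
    rw [← Complex.ofReal_one, ← Complex.ofReal_sub, ← Complex.ofReal_cpow hp.le,
      ← Real.rpow_mul hl'.le]
    congr 2
    field_simp
  rw [e, ← mul_assoc, ← mul_assoc, ← Complex.ofReal_mul, ← Complex.ofReal_mul]
  congr 2
  have : l ^ (-a) = l ^ (α - 1) * l ^ (1 - a - α) := by
    rw [← Real.rpow_add hl']; congr 1; ring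
  rw [this]; field_simp

lemma exp_I_cpow {θ δ : ℝ} (h1 : -π < θ) (h2 : θ ≤ π) :
    Complex.exp ((θ : ℂ) * Complex.I) ^ (δ : ℂ) = Complex.exp (((θ * δ : ℝ) : ℂ) * Complex.I) := by
  rw [Complex.cpow_def_of_ne_zero (Complex.exp_ne_zero _), Complex.log_exp (by simpa) (by simpa)]
  push_cast; ring_nf

lemma half_integral {α B a θ : ℝ} (hα : 0 < α) (hB : 0 < B) (ha : a < 1)
    (ht1 : -(π / 2) < θ) (ht2 : θ < π / 2) :
    ∫ l in Ioi (0 : ℝ), ((l ^ (-a) : ℝ) : ℂ) *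
        Complex.exp (-(B * Complex.exp ((θ : ℂ) * Complex.I) * ((l ^ α : ℝ) : ℂ)))
      = ((1 / α * B ^ (-((1 - a) / α)) * Real.Gamma ((1 - a) / α) : ℝ) : ℂ) *
          Complex.exp (((-θ * ((1 - a) / α) : ℝ) : ℂ) * Complex.I) := by
  rw [rpow_exp_integral hα ha]
  · have hB' : (B : ℂ) ≠ 0 := by exact_mod_cast hB.ne'
    have e : 1 / ((B : ℂ) * Complex.exp ((θ : ℂ) * Complex.I))
        = ((B⁻¹ : ℝ) : ℂ) * Complex.exp (((-θ : ℝ) : ℂ) * Complex.I) := by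
      rw [one_div, mul_inv, ← Complex.exp_neg]
      push_cast; ring_nf
    rw [e, pos_mul_cpow (inv_pos.2 hB) (Complex.exp_ne_zero _),
      exp_I_cpow (by linarith [Real.pi_pos]) (by linarith [Real.pi_pos]),
      Real.inv_rpow hB.le, ← Real.rpow_neg hB.le, Complex.Gamma_ofReal]
    push_cast; ring
  · rw [Complex.re_ofReal_mul, Complex.exp_ofReal_mul_I_re]
    exact mul_pos hB (Real.cos_pos_of_mem_Ioo ⟨by linarith, ht2⟩)

lemma gfun_pos {α B l : ℝ} (hl : 0 < l) :
    gfun α B ((l : ℂ) * Complex.I) = Complex.exp (-(B *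
      Complex.exp (((-(π * (1 - α / 2)) : ℝ) : ℂ) * Complex.I) * ((l ^ α : ℝ) : ℂ))) := by
  rw [gfun, pos_mul_cpow hl Complex.I_ne_zero, I_cpow]
  have : Complex.exp (((-(π * (1 - α / 2)) : ℝ) : ℂ) * Complex.I)
      = -Complex.exp (((π * α / 2 : ℝ) : ℂ) * Complex.I) := by
    rw [← Complex.exp_sub_pi_mul_I]
    congr 1; push_cast; ring
  rw [this]; congr 1; ring

lemma gfun_neg {α B l : ℝ} (hl : 0 < l) :
    gfun α B (((-l : ℝ) : ℂ) * Complex.I) = Complex.exp (-(B *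
      Complex.exp (((π * (1 - α / 2) : ℝ) : ℂ) * Complex.I) * ((l ^ α : ℝ) : ℂ))) := by
  have e0 : ((-l : ℝ) : ℂ) * Complex.I = (l : ℂ) * (-Complex.I) := by push_cast; ring
  rw [gfun, e0, pos_mul_cpow hl (neg_ne_zero.2 Complex.I_ne_zero), negI_cpow]
  have : Complex.exp (((π * (1 - α / 2) : ℝ) : ℂ) * Complex.I)
      = -Complex.exp (((-(π * α / 2) : ℝ) : ℂ) * Complex.I) := by
    rw [← Complex.exp_add_pi_mul_I]
    congr 1; push_cast; ring
  rw [this]; congr 1; ring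

lemma inv_pos_cpow {a l : ℝ} (hl : 0 < l) :
    (1 / ((l : ℂ) * Complex.I)) ^ (a : ℂ)
      = ((l ^ (-a) : ℝ) : ℂ) * Complex.exp (((-(π * a / 2) : ℝ) : ℂ) * Complex.I) := by
  have e : 1 / ((l : ℂ) * Complex.I) = ((l⁻¹ : ℝ) : ℂ) * (-Complex.I) := by
    rw [one_div, mul_inv, Complex.inv_I]; push_cast; ring
  rw [e, pos_mul_cpow (inv_pos.2 hl) (neg_ne_zero.2 Complex.I_ne_zero), negI_cpow,
    Real.inv_rpow hl.le, ← Real.rpow_neg hl.le]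

lemma inv_neg_cpow {a l : ℝ} (hl : 0 < l) :
    (1 / (((-l : ℝ) : ℂ) * Complex.I)) ^ (a : ℂ)
      = ((l ^ (-a) : ℝ) : ℂ) * Complex.exp (((π * a / 2 : ℝ) : ℂ) * Complex.I) := by
  have e : 1 / (((-l : ℝ) : ℂ) * Complex.I) = ((l⁻¹ : ℝ) : ℂ) * Complex.I := by
    rw [one_div, mul_inv, Complex.inv_I]; push_cast; rw [inv_neg]; ring
  rw [e, pos_mul_cpow (inv_pos.2 hl) Complex.I_ne_zero, I_cpow,
    Real.inv_rpow hl.le, ← Real.rpow_neg hl.le]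

lemma inv_line_cpow_norm {a : ℝ} (ha : 0 < a) {e l : ℝ} (hl : l ≠ 0) :
    ‖(1 / ((e : ℂ) + (l : ℂ) * Complex.I)) ^ (a : ℂ)‖ ≤ |l| ^ (-a) := by
  have h0 : |l| ≤ ‖(e : ℂ) + (l : ℂ) * Complex.I‖ := by
    simpa using Complex.abs_im_le_norm ((e : ℂ) + (l : ℂ) * Complex.I)
  rw [Complex.norm_cpow_real, norm_div, norm_one, one_div, Real.inv_rpow (norm_nonneg _),
    ← Real.rpow_neg (norm_nonneg _)]
  exact Real.rpow_le_rpow_of_nonpos (abs_pos.2 hl) h0 (by linarith)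

lemma inv_line_meas (a : ℝ) (e : ℝ) :
    AEStronglyMeasurable (fun l : ℝ => (1 / ((e : ℂ) + (l : ℂ) * Complex.I)) ^ (a : ℂ)) := by
  refine Measurable.aestronglyMeasurable ?_
  fun_prop

lemma dom_integrable {α B a : ℝ} (h1 : 1 < α) (h2 : α ≤ 2) (hB : 0 < B) (ha1 : a < 1) :
    Integrable (fun l : ℝ => |l| ^ (-a) * ‖gfun α B ((l : ℂ) * Complex.I)‖) := by
  obtain ⟨m, hm, δ, hδ, H⟩ := gfun_decay h1 h2 hB
  refine Integrable.mono' (integrable_abs_rpow_exp (a := -a) (by linarith) h1 hm) ?_ ?_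
  · have hc := gfun_line_cont (α := α) (B := B) h1 (c := 0) le_rfl
    rw [Complex.ofReal_zero] at hc
    simp only [zero_add] at hc
    refine AEStronglyMeasurable.mul ?_ hc.norm.aestronglyMeasurable
    refine Measurable.aestronglyMeasurable ?_
    fun_prop
  · refine Filter.Eventually.of_forall fun l => ?_
    have := H 0 l le_rfl (by positivity)
    rw [Complex.ofReal_zero, zero_add] at this
    have hp : 0 ≤ |l| ^ (-a) := by positivity
    rw [Real.norm_of_nonneg (by positivity)]
    gcongr

lemma line_value {α B a : ℝ} (h1 : 1 < α) (h2 : α ≤ 2) (hB : 0 < B) (ha0 : 0 < a) (ha1 : a < 1) :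
    ∫ l : ℝ, (1 / ((l : ℂ) * Complex.I)) ^ (a : ℂ) * gfun α B ((l : ℂ) * Complex.I)
      = ((2 * π * (1 / α) * B ^ (-((1 - a) / α)) * (Real.Gamma (1 - (1 - a) / α))⁻¹ : ℝ) : ℂ) := by
  have hα : 0 < α := by linarith
  set δ := (1 - a) / α with hδ
  have hδ0 : 0 < δ := div_pos (by linarith) hα
  have hδ1 : δ < 1 := by rw [hδ, div_lt_one hα]; linarith
  have hint : Integrable (fun l : ℝ =>
      (1 / ((l : ℂ) * Complex.I)) ^ (a : ℂ) * gfun α B ((l : ℂ) * Complex.I)) := by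
    refine Integrable.mono' (dom_integrable h1 h2 hB ha1) ?_ ?_
    · have hm := inv_line_meas a 0
      have hc := gfun_line_cont (α := α) (B := B) h1 (c := 0) le_rfl
      rw [Complex.ofReal_zero] at hc hm
      simp only [zero_add] at hc hm
      exact hm.mul hc.aestronglyMeasurable
    · have : ∀ᵐ l : ℝ, l ≠ 0 := by simp [ae_iff]
      filter_upwards [this] with l hl
      rw [norm_mul]
      have := inv_line_cpow_norm ha0 (e := 0) hl
      rw [Complex.ofReal_zero, zero_add] at this
      gcongr
  rw [← integral_add_compl measurableSet_Ioi hint (s := Ioi 0), compl_Ioi]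
  have hn : ∫ l in Iic (0 : ℝ),
      (1 / ((l : ℂ) * Complex.I)) ^ (a : ℂ) * gfun α B ((l : ℂ) * Complex.I)
      = ∫ l in Ioi (0 : ℝ), (1 / (((-l : ℝ) : ℂ) * Complex.I)) ^ (a : ℂ) *
          gfun α B (((-l : ℝ) : ℂ) * Complex.I) := by
    have := integral_comp_neg_Ioi 0 (fun l : ℝ =>
      (1 / ((l : ℂ) * Complex.I)) ^ (a : ℂ) * gfun α B ((l : ℂ) * Complex.I))
    rw [neg_zero] at this
    exact this.symm
  have hpi := Real.pi_pos
  have hp : ∫ l in Ioi (0 : ℝ),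
      (1 / ((l : ℂ) * Complex.I)) ^ (a : ℂ) * gfun α B ((l : ℂ) * Complex.I)
      = Complex.exp (((-(π * a / 2) : ℝ) : ℂ) * Complex.I) *
        (((1 / α * B ^ (-δ) * Real.Gamma δ : ℝ) : ℂ) *
          Complex.exp (((-(-(π * (1 - α / 2))) * δ : ℝ) : ℂ) * Complex.I)) := by
    rw [← half_integral hα hB ha1 (by nlinarith) (by nlinarith), ← integral_const_mul]
    refine setIntegral_congr_fun measurableSet_Ioi fun l hl => ?_
    rw [inv_pos_cpow hl, gfun_pos hl]; ring
  have hn' : ∫ l in Ioi (0 : ℝ), (1 / (((-l : ℝ) : ℂ) * Complex.I)) ^ (a : ℂ) *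
          gfun α B (((-l : ℝ) : ℂ) * Complex.I)
      = Complex.exp (((π * a / 2 : ℝ) : ℂ) * Complex.I) *
        (((1 / α * B ^ (-δ) * Real.Gamma δ : ℝ) : ℂ) *
          Complex.exp (((-(π * (1 - α / 2)) * δ : ℝ) : ℂ) * Complex.I)) := by
    rw [← half_integral hα hB ha1 (by nlinarith) (by nlinarith), ← integral_const_mul]
    refine setIntegral_congr_fun measurableSet_Ioi fun l hl => ?_
    rw [inv_neg_cpow hl, gfun_neg hl]; ring
  rw [hn, hn', hp]
  have hph : α * δ = 1 - a := by rw [hδ]; field_simp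
  have ph1 : Complex.exp (((-(π * a / 2) : ℝ) : ℂ) * Complex.I) *
      Complex.exp (((-(-(π * (1 - α / 2))) * δ : ℝ) : ℂ) * Complex.I)
      = Complex.exp (((π * δ - π / 2 : ℝ) : ℂ) * Complex.I) := by
    rw [← Complex.exp_add, ← add_mul, ← Complex.ofReal_add]
    congr 3
    linear_combination (-π / 2) * hph
  have ph2 : Complex.exp (((π * a / 2 : ℝ) : ℂ) * Complex.I) *
      Complex.exp (((-(π * (1 - α / 2)) * δ : ℝ) : ℂ) * Complex.I)
      = Complex.exp (-((π * δ - π / 2 : ℝ) : ℂ) * Complex.I) := by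
    rw [← Complex.exp_add, ← add_mul, ← Complex.ofReal_add, ← Complex.ofReal_neg]
    congr 3
    linear_combination (π / 2) * hph
  have hcos : Complex.exp (((π * δ - π / 2 : ℝ) : ℂ) * Complex.I) +
      Complex.exp (-((π * δ - π / 2 : ℝ) : ℂ) * Complex.I) = ((2 * Real.sin (π * δ) : ℝ) : ℂ) := by
    rw [← Complex.two_cos, ← Complex.ofReal_cos, Real.cos_sub_pi_div_two]
    push_cast; ring
  have hfin : 1 / α * B ^ (-δ) * Real.Gamma δ * (2 * Real.sin (π * δ))
      = 2 * π * (1 / α) * B ^ (-δ) * (Real.Gamma (1 - δ))⁻¹ := by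
    have hs : 0 < Real.sin (π * δ) := Real.sin_pos_of_pos_of_lt_pi (by positivity) (by nlinarith)
    have hg : 0 < Real.Gamma (1 - δ) := Real.Gamma_pos_of_pos (by linarith)
    have hr := Real.Gamma_mul_Gamma_one_sub δ
    rw [eq_div_iff hs.ne'] at hr
    rw [← div_eq_mul_inv, eq_div_iff hg.ne']
    linear_combination (2 * (1 / α) * B ^ (-δ)) * hr
  rw [← hfin, Complex.ofReal_mul (1 / α * B ^ (-δ) * Real.Gamma δ) (2 * Real.sin (π * δ)), ← hcos, ← ph1, ← ph2]
  ring

lemma Qf_damped {α B a e : ℝ} (h1 : 1 < α) (h2 : α ≤ 2) (hB : 0 < B) (ha0 : 0 < a) (he : 0 < e) :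
    ∫ x in Ioi (0 : ℝ), (x : ℂ) ^ ((a : ℂ) - 1) * Complex.exp (-((e : ℂ) * x)) * Qf α B x
      = Complex.Gamma a * ∫ l : ℝ, (1 / ((e : ℂ) + (l : ℂ) * Complex.I)) ^ (a : ℂ) *
          gfun α B ((l : ℂ) * Complex.I) := by
  have hi := gfun_integrable h1 h2 hB (c := 0) le_rfl
  rw [Complex.ofReal_zero] at hi
  simp only [zero_add] at hi
  have hk : Integrable (fun x : ℝ => (x : ℂ) ^ ((a : ℂ) - 1) * Complex.exp (-((e : ℂ) * x)))
      (volume.restrict (Ioi 0)) := by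
    refine Integrable.mono' (aux_int_gamma ha0 he) (aux_meas a e) ?_
    filter_upwards [ae_restrict_mem measurableSet_Ioi] with x hx
    rw [aux_norm a e hx]; simp
  have hprod := hk.mul_prod hi
  have hprod2 : Integrable (Function.uncurry fun (x l : ℝ) =>
      ((x : ℂ) ^ ((a : ℂ) - 1) * Complex.exp (-((e : ℂ) * x))) *
        (Complex.exp (-(((l : ℂ) * Complex.I) * x)) * gfun α B ((l : ℂ) * Complex.I)))
      ((volume.restrict (Ioi 0)).prod volume) := by
    have := hprod.bdd_mul (c := 1)
      (f := fun p : ℝ × ℝ => Complex.exp (-(((p.2 : ℂ) * Complex.I) * p.1)))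
      (Continuous.aestronglyMeasurable (by fun_prop))
      (Filter.Eventually.of_forall fun p => by
        have := exp_line_norm 0 p.2 p.1
        rw [Complex.ofReal_zero, zero_add] at this
        rw [this]; simp)
    refine this.congr (Filter.Eventually.of_forall fun p => ?_)
    simp only [Function.uncurry]
    ring
  have hsw := integral_integral_swap hprod2
  have hL : ∫ x in Ioi (0 : ℝ), (x : ℂ) ^ ((a : ℂ) - 1) * Complex.exp (-((e : ℂ) * x)) * Qf α B x
      = ∫ x in Ioi (0 : ℝ), ∫ l : ℝ, ((x : ℂ) ^ ((a : ℂ) - 1) * Complex.exp (-((e : ℂ) * x))) *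
        (Complex.exp (-(((l : ℂ) * Complex.I) * x)) * gfun α B ((l : ℂ) * Complex.I)) := by
    refine setIntegral_congr_fun measurableSet_Ioi fun x hx => ?_
    simp only [Qf]
    rw [← integral_const_mul]
  rw [hL, hsw, ← integral_const_mul]
  congr 1
  ext l
  have hg := gammaC (a := a) (r := (e : ℂ) + (l : ℂ) * Complex.I) ha0 (by simpa using he)
  have : Complex.Gamma a * ((1 / ((e : ℂ) + (l : ℂ) * Complex.I)) ^ (a : ℂ) *
          gfun α B ((l : ℂ) * Complex.I)) = ((1 / ((e : ℂ) + (l : ℂ) * Complex.I)) ^ (a : ℂ) *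
          Complex.Gamma a) * gfun α B ((l : ℂ) * Complex.I) := by ring
  rw [this, ← hg, ← integral_mul_const]
  refine setIntegral_congr_fun measurableSet_Ioi fun x hx => ?_
  have e2 : Complex.exp (-(((e : ℂ) + (l : ℂ) * Complex.I) * x))
      = Complex.exp (-((e : ℂ) * x)) * Complex.exp (-(((l : ℂ) * Complex.I) * x)) := by
    rw [← Complex.exp_add]; congr 1; ring
  rw [e2]; ring

lemma Qf_bigO_top {α B : ℝ} (h1 : 1 < α) (h2 : α ≤ 2) (hB : 0 < B) :
    Qf α B =O[Filter.atTop] fun t => Real.exp (-1 * t) := by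
  obtain ⟨C, hC, H⟩ := Qf_bound h1 h2 hB (c := 1) zero_le_one
  refine Asymptotics.IsBigO.of_bound C ?_
  filter_upwards [Filter.eventually_ge_atTop 0] with x hx
  rw [Real.norm_of_nonneg (Real.exp_pos _).le]
  have := H x hx
  rwa [← neg_mul] at this

lemma Qf_bigO_zero {α B : ℝ} (h1 : 1 < α) (h2 : α ≤ 2) (hB : 0 < B) :
    Qf α B =O[nhdsWithin 0 (Ioi 0)] fun t => t ^ (-(0 : ℝ)) := by
  obtain ⟨C, hC, H⟩ := Qf_bound h1 h2 hB (c := 0) le_rfl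
  refine Asymptotics.IsBigO.of_bound C ?_
  filter_upwards [self_mem_nhdsWithin] with x hx
  have := H x (le_of_lt hx)
  simpa using this

lemma Qf_mellinConv {α B : ℝ} (h1 : 1 < α) (h2 : α ≤ 2) (hB : 0 < B) {s : ℂ} (hs : 0 < s.re) :
    MellinConvergent (Qf α B) s :=
  mellinConvergent_of_isBigO_rpow_exp one_pos
    ((Qf_cont h1 h2 hB).locallyIntegrable.locallyIntegrableOn _)
    (Qf_bigO_top h1 h2 hB) (Qf_bigO_zero h1 h2 hB) hs

lemma Qf_mellinDiff {α B : ℝ} (h1 : 1 < α) (h2 : α ≤ 2) (hB : 0 < B) {s : ℂ} (hs : 0 < s.re) :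
    DifferentiableAt ℂ (mellin (Qf α B)) s :=
  mellin_differentiableAt_of_isBigO_rpow_exp one_pos
    ((Qf_cont h1 h2 hB).locallyIntegrable.locallyIntegrableOn _)
    (Qf_bigO_top h1 h2 hB) (Qf_bigO_zero h1 h2 hB) hs

lemma Qf_mellin_small {α B a : ℝ} (h1 : 1 < α) (h2 : α ≤ 2) (hB : 0 < B) (ha0 : 0 < a)
    (ha1 : a < 1) :
    mellin (Qf α B) a = Complex.Gamma a *
      ((2 * π * (1 / α) * B ^ (-((1 - a) / α)) * (Real.Gamma (1 - (1 - a) / α))⁻¹ : ℝ) : ℂ) := by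
  have hconv := Qf_mellinConv h1 h2 hB (s := a) (by simpa using ha0)
  unfold MellinConvergent at hconv
  simp only [smul_eq_mul] at hconv
  have hi := gfun_integrable h1 h2 hB (c := 0) le_rfl
  rw [Complex.ofReal_zero] at hi
  simp only [zero_add] at hi
  -- limits of both sides
  have hL : Filter.Tendsto (fun e : ℝ => ∫ x in Ioi (0 : ℝ),
      (x : ℂ) ^ ((a : ℂ) - 1) * Complex.exp (-((e : ℂ) * x)) * Qf α B x)
      (nhdsWithin 0 (Ioi 0)) (nhds (mellin (Qf α B) a)) := by
    unfold mellin
    simp only [smul_eq_mul]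
    refine tendsto_integral_filter_of_dominated_convergence
      (fun x : ℝ => ‖(x : ℂ) ^ ((a : ℂ) - 1) * Qf α B x‖) ?_ ?_ hconv.norm ?_
    · refine Filter.Eventually.of_forall fun e => ?_
      exact (aux_meas a e).mul (Qf_cont h1 h2 hB).aestronglyMeasurable
    · filter_upwards [self_mem_nhdsWithin] with e he
      have he' : 0 < e := he
      filter_upwards [ae_restrict_mem measurableSet_Ioi] with x hx
      have hx' : 0 < x := hx
      rw [mul_right_comm, norm_mul]
      have : ‖Complex.exp (-((e : ℂ) * x))‖ ≤ 1 := by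
        rw [Complex.norm_exp]
        simp only [Complex.neg_re, Complex.re_ofReal_mul, Complex.ofReal_re]
        exact Real.exp_le_one_iff.2 (by nlinarith)
      exact mul_le_of_le_one_right (norm_nonneg _) this
    · refine Filter.Eventually.of_forall fun x => ?_
      have : Continuous (fun e : ℝ =>
          (x : ℂ) ^ ((a : ℂ) - 1) * Complex.exp (-((e : ℂ) * x)) * Qf α B x) := by fun_prop
      refine Filter.Tendsto.mono_left ?_ nhdsWithin_le_nhds
      exact this.tendsto' _ _ (by simp)
  have hR : Filter.Tendsto (fun e : ℝ => Complex.Gamma a *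
      ∫ l : ℝ, (1 / ((e : ℂ) + (l : ℂ) * Complex.I)) ^ (a : ℂ) *
          gfun α B ((l : ℂ) * Complex.I))
      (nhdsWithin 0 (Ioi 0)) (nhds (Complex.Gamma a *
      ∫ l : ℝ, (1 / ((l : ℂ) * Complex.I)) ^ (a : ℂ) *
          gfun α B ((l : ℂ) * Complex.I))) := by
    refine Filter.Tendsto.const_mul _ ?_
    have hne : ∀ᵐ l : ℝ, l ≠ 0 := by simp [ae_iff]
    refine tendsto_integral_filter_of_dominated_convergence
      (fun l : ℝ => |l| ^ (-a) * ‖gfun α B ((l : ℂ) * Complex.I)‖) ?_ ?_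
      (dom_integrable h1 h2 hB ha1) ?_
    · exact Filter.Eventually.of_forall fun e => (inv_line_meas a e).mul hi.aestronglyMeasurable
    · refine Filter.Eventually.of_forall fun e => ?_
      filter_upwards [hne] with l hl
      rw [norm_mul]
      have := inv_line_cpow_norm ha0 (e := e) hl
      gcongr
    · filter_upwards [hne] with l hl
      refine Filter.Tendsto.mul_const _ ?_
      refine Filter.Tendsto.mono_left ?_ nhdsWithin_le_nhds
      have hl' : (l : ℂ) ≠ 0 := by exact_mod_cast hl
      have hc : ContinuousAt (fun e : ℝ => (1 / ((e : ℂ) + (l : ℂ) * Complex.I)) ^ (a : ℂ)) 0 := by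
        refine ContinuousAt.cpow ?_ continuousAt_const ?_
        · refine ContinuousAt.div continuousAt_const (by fun_prop) ?_
          simpa using hl
        · right
          simpa using hl
      have := hc.tendsto
      simpa using this
  have := tendsto_nhds_unique hL (hR.congr' (by
    filter_upwards [self_mem_nhdsWithin] with e he
    exact (Qf_damped h1 h2 hB ha0 he).symm))
  rw [this, line_value h1 h2 hB ha0 ha1]

lemma Qf_mellin {α B : ℝ} (h1 : 1 < α) (h2 : α ≤ 2) (hB : 0 < B) {s : ℂ} (hs : 0 < s.re) :
    mellin (Qf α B) s = Complex.Gamma s *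
      (2 * π * (1 / α) * (B : ℂ) ^ (-((1 - s) / α)) * (Complex.Gamma (1 - (1 - s) / α))⁻¹) := by
  have hB' : (B : ℂ) ≠ 0 := by exact_mod_cast hB.ne'
  have hU : IsOpen {z : ℂ | 0 < z.re} := isOpen_lt continuous_const Complex.continuous_re
  have hd1 : DifferentiableOn ℂ (mellin (Qf α B)) {z : ℂ | 0 < z.re} := fun w hw =>
    (Qf_mellinDiff h1 h2 hB hw).differentiableWithinAt
  have hd2 : DifferentiableOn ℂ (fun s : ℂ => Complex.Gamma s *
      (2 * π * (1 / α) * (B : ℂ) ^ (-((1 - s) / α)) * (Complex.Gamma (1 - (1 - s) / α))⁻¹))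
      {z : ℂ | 0 < z.re} := by
    intro w hw
    have hw' : 0 < w.re := hw
    refine DifferentiableAt.differentiableWithinAt ?_
    refine DifferentiableAt.mul ?_ ?_
    · refine Complex.differentiableAt_Gamma _ fun m hm => ?_
      rw [hm] at hw'
      simp at hw'
      have : (0 : ℝ) ≤ m := Nat.cast_nonneg m
      linarith
    · refine DifferentiableAt.mul ?_ ?_
      · refine DifferentiableAt.const_mul ?_ _
        exact DifferentiableAt.const_cpow (by fun_prop) (Or.inl hB')
      · exact (Complex.differentiable_one_div_Gamma _).comp (f := fun s : ℂ => 1 - (1 - s) / α) w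
          (by fun_prop)
  have h := (hd1.analyticOnNhd hU).eqOn_of_preconnected_of_frequently_eq
    (hd2.analyticOnNhd hU) (z₀ := ((1 / 2 : ℝ) : ℂ))
    (convex_halfSpace_re_gt 0).isPreconnected (by
      rw [mem_ofPred_eq, Complex.ofReal_re]; norm_num) ?_
  · exact h hs
  · have ht : Filter.Tendsto (fun x : ℝ => (x : ℂ)) (nhdsWithin (1 / 2) {1 / 2}ᶜ)
        (nhdsWithin ((1 / 2 : ℝ) : ℂ) {((1 / 2 : ℝ) : ℂ)}ᶜ) := by
      refine tendsto_nhdsWithin_iff.2 ⟨?_, ?_⟩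
      · exact (Complex.continuous_ofReal.tendsto (1 / 2)).mono_left nhdsWithin_le_nhds
      · filter_upwards [self_mem_nhdsWithin] with x hx
        intro hx'
        exact hx (Complex.ofReal_injective hx')
    refine ht.frequently ?_
    refine Filter.Eventually.frequently ?_
    have : ∀ᶠ x : ℝ in nhdsWithin (1 / 2) {1 / 2}ᶜ, x ∈ Ioo (0 : ℝ) 1 :=
      nhdsWithin_le_nhds (Ioo_mem_nhds (by norm_num) (by norm_num))
    filter_upwards [this] with x hx
    rw [Qf_mellin_small h1 h2 hB hx.1 hx.2]
    congr 1
    have e1 : (1 - (1 - (x : ℂ)) / α) = ((1 - (1 - x) / α : ℝ) : ℂ) := by push_cast; ring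
    have e2 : -((1 - (x : ℂ)) / α) = ((-((1 - x) / α) : ℝ) : ℂ) := by push_cast; ring
    rw [e1, e2, Complex.Gamma_ofReal, ← Complex.ofReal_cpow hB.le]
    push_cast; ring

/-- Integer moments. -/
lemma Qf_moment {α B : ℝ} (h1 : 1 < α) (h2 : α ≤ 2) (hB : 0 < B) (k : ℕ) :
    ∫ x in Ioi (0 : ℝ), (x : ℂ) ^ k * Qf α B x
      = ((2 * π * (1 / α) * (k.factorial * (B ^ (1 / α)) ^ k / Real.Gamma (1 + 1 / α * k)) : ℝ) : ℂ)
      := by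
  have h := Qf_mellin h1 h2 hB (s := (k : ℂ) + 1) (by
    rw [Complex.add_re, Complex.natCast_re, Complex.one_re]; positivity)
  unfold mellin at h
  simp only [add_sub_cancel_right, Complex.cpow_natCast, smul_eq_mul] at h
  rw [h, Complex.Gamma_nat_eq_factorial]
  have e1 : (1 - (1 - ((k : ℂ) + 1)) / α) = ((1 + 1 / α * k : ℝ) : ℂ) := by push_cast; ring
  have e2 : -((1 - ((k : ℂ) + 1)) / α) = ((1 / α * k : ℝ) : ℂ) := by push_cast; ring
  rw [e1, e2, Complex.Gamma_ofReal, ← Complex.ofReal_cpow hB.le, Real.rpow_mul hB.le,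
    Real.rpow_natCast]
  push_cast; ring

lemma zolDensity_eq {α B : ℝ} (h1 : 1 < α) (x : ℝ) :
    zolDensity α (2 - α) B x = (1 / (2 * π)) * (Qf α B x).re := by
  unfold zolDensity Qf
  congr 3
  ext l
  congr 1
  · congr 1; ring
  · rcases lt_trichotomy l 0 with hl | hl | hl
    · have hl' : 0 < -l := by linarith
      have := gfun_neg (α := α) (B := B) hl'
      rw [neg_neg] at this
      rw [this, abs_of_neg hl, Real.sign_of_neg hl]
      have e : -Complex.I * (π : ℂ) * ((2 - α : ℝ) : ℂ) * ((-1 : ℝ) : ℂ) / 2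
          = ((π * (1 - α / 2) : ℝ) : ℂ) * Complex.I := by push_cast; ring
      rw [e]; congr 1; ring
    · subst hl
      have hα : α ≠ 0 := by linarith
      simp [gfun, Real.zero_rpow hα, hα]
    · rw [gfun_pos hl, abs_of_pos hl, Real.sign_of_pos hl]
      have e : -Complex.I * (π : ℂ) * ((2 - α : ℝ) : ℂ) * ((1 : ℝ) : ℂ) / 2
          = ((-(π * (1 - α / 2)) : ℝ) : ℂ) * Complex.I := by push_cast; ring
      rw [e]; congr 1; ring

lemma Qf_laplace {α B z : ℝ} (h1 : 1 < α) (h2 : α ≤ 2) (hB : 0 < B) (hz : 0 ≤ z) :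
    HasSum (fun k : ℕ => ((2 * π * (1 / α) *
        ((-(z * B ^ (1 / α))) ^ k / Real.Gamma (1 + 1 / α * k)) : ℝ) : ℂ))
      (∫ x in Ioi (0 : ℝ), Complex.exp (-((z : ℂ) * x)) * Qf α B x) := by
  obtain ⟨C, hC, H⟩ := Qf_bound h1 h2 hB (c := z + 1) (by linarith)
  set F : ℕ → ℝ → ℂ := fun k x =>
    ((-z) ^ k / k.factorial : ℂ) * ((x : ℂ) ^ k * Qf α B x) with hF
  have hmeas : ∀ k, AEStronglyMeasurable (F k) (volume.restrict (Ioi 0)) := fun k => by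
    have := Qf_cont h1 h2 hB
    exact Continuous.aestronglyMeasurable (by fun_prop)
  -- dominating functions
  have hG : ∀ k : ℕ, IntegrableOn (fun x : ℝ => z ^ k / k.factorial * C *
      (x ^ (((k : ℝ) + 1) - 1) * Real.exp (-(z + 1) * x))) (Ioi 0) := fun k =>
    (aux_int_gamma (by positivity) (by linarith)).const_mul _
  have hle : ∀ k : ℕ, ∀ x ∈ Ioi (0 : ℝ), ‖F k x‖ ≤ z ^ k / k.factorial * C *
      (x ^ (((k : ℝ) + 1) - 1) * Real.exp (-(z + 1) * x)) := by
    intro k x hx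
    have hx' : 0 < x := hx
    rw [add_sub_cancel_right, Real.rpow_natCast]
    simp only [hF, norm_mul, norm_div, norm_pow, norm_neg, Complex.norm_real,
      Complex.norm_natCast, Real.norm_of_nonneg hz, Real.norm_of_nonneg hx'.le]
    have := H x hx'.le
    rw [← neg_mul] at this
    calc z ^ k / k.factorial * (x ^ k * ‖Qf α B x‖)
        ≤ z ^ k / k.factorial * (x ^ k * (C * Real.exp (-(z + 1) * x))) := by gcongr
      _ = _ := by ring
  have hint : ∀ k, Integrable (F k) (volume.restrict (Ioi 0)) := fun k =>
    Integrable.mono' (hG k) (hmeas k) (by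
      filter_upwards [ae_restrict_mem measurableSet_Ioi] with x hx
      exact hle k x hx)
  have hnorm : ∀ k, ∫ x in Ioi (0 : ℝ), ‖F k x‖ ≤ C / (z + 1) * (z / (z + 1)) ^ k := by
    intro k
    refine (setIntegral_mono_on (hint k).norm (hG k) measurableSet_Ioi (hle k)).trans
      (le_of_eq ?_)
    rw [integral_const_mul]
    have := Real.integral_rpow_mul_exp_neg_mul_Ioi (a := (k : ℝ) + 1) (r := z + 1)
      (by positivity) (by linarith)
    simp only [← neg_mul] at this
    rw [this, Real.Gamma_nat_eq_factorial]
    have hf : (k.factorial : ℝ) ≠ 0 := by positivity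
    have hz1 : z + 1 ≠ 0 := by linarith
    have e : (1 / (z + 1)) ^ ((k : ℝ) + 1) = (1 / (z + 1)) ^ k * (1 / (z + 1)) := by
      rw [← Real.rpow_natCast, ← Real.rpow_add_one (by positivity)]
    rw [e, div_pow, div_pow, one_pow]
    field_simp
  have hsum : Summable fun k => ∫ x in Ioi (0 : ℝ), ‖F k x‖ := by
    refine Summable.of_nonneg_of_le (fun k => integral_nonneg fun _ => norm_nonneg _) hnorm ?_
    refine (summable_geometric_of_lt_one (by positivity) ?_).mul_left _
    rw [div_lt_one (by linarith)]; linarith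
  have hs := hasSum_integral_of_summable_integral_norm hint hsum
  have hv : ∀ k, ∫ x in Ioi (0 : ℝ), F k x = ((2 * π * (1 / α) *
        ((-(z * B ^ (1 / α))) ^ k / Real.Gamma (1 + 1 / α * k)) : ℝ) : ℂ) := by
    intro k
    simp only [hF]
    rw [integral_const_mul, Qf_moment h1 h2 hB k, ← neg_mul, mul_pow]
    have hf : (k.factorial : ℂ) ≠ 0 := by exact_mod_cast k.factorial_ne_zero
    push_cast
    field_simp
  have ht : ∫ x in Ioi (0 : ℝ), ∑' k, F k x
      = ∫ x in Ioi (0 : ℝ), Complex.exp (-((z : ℂ) * x)) * Qf α B x := by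
    refine setIntegral_congr_fun measurableSet_Ioi fun x hx => ?_
    have he := (NormedSpace.expSeries_div_hasSum_exp (-((z : ℂ) * x))).mul_right (Qf α B x)
    rw [← Complex.exp_eq_exp_ℂ] at he
    rw [← he.tsum_eq]
    refine tsum_congr fun k => ?_
    simp only [hF]
    rw [← neg_mul, mul_pow]; ring
  rw [ht] at hs
  simp only [hv] at hs
  exact hs

/-- The conditional law of a spectrally negative stable process given positivity is
Mittag-Leffler. -/
theorem spectrally_negative_conditional_mittagLeffler (α b : ℝ) (hα1 : 1 < α) (hα2 : α ≤ 2)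
    (hb : 0 < b) (γ : ℝ) (hγ : γ = 1 / α)
    (P : ℝ → ℝ → ℝ) (hP : ∀ x t, P x t = zolDensity α (2 - α) (b ^ (-α) * t) x) :
    ∀ t z : ℝ, 0 < t → 0 ≤ z →
      ∫ x in Set.Ioi (0 : ℝ), Real.exp (-(z * x)) * P x t =
        γ * mittagLeffler γ (-(z * b⁻¹ * t ^ γ)) := by
  intro t z ht hz
  have hα : 0 < α := by linarith
  set B := b ^ (-α) * t with hBdef
  have hB : 0 < B := mul_pos (Real.rpow_pos_of_pos hb _) ht
  have hBγ : B ^ (1 / α) = b⁻¹ * t ^ γ := by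
    rw [hBdef, Real.mul_rpow (Real.rpow_pos_of_pos hb _).le ht.le, ← Real.rpow_mul hb.le, hγ]
    congr 1
    rw [← Real.rpow_neg_one]; congr 1; field_simp
  have hs := Qf_laplace hα1 hα2 hB hz
  have hint : Integrable (fun x : ℝ => Complex.exp (-((z : ℂ) * x)) * Qf α B x)
      (volume.restrict (Ioi 0)) := by
    have h := Qf_mellinConv hα1 hα2 hB (s := 1) (by simp)
    unfold MellinConvergent at h
    simp only [sub_self, Complex.cpow_zero, one_smul] at h
    refine Integrable.bdd_mul (c := 1) h
      (Continuous.aestronglyMeasurable (by fun_prop)) ?_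
    filter_upwards [ae_restrict_mem measurableSet_Ioi] with x hx
    have hx' : 0 < x := hx
    rw [Complex.norm_exp]
    simp only [Complex.neg_re, Complex.re_ofReal_mul, Complex.ofReal_re]
    exact Real.exp_le_one_iff.2 (by nlinarith)
  have hlhs : ∫ x in Set.Ioi (0 : ℝ), Real.exp (-(z * x)) * P x t
      = (1 / (2 * π)) * (∫ x in Ioi (0 : ℝ), Complex.exp (-((z : ℂ) * x)) * Qf α B x).re := by
    have hre := integral_re hint
    simp only [RCLike.re_eq_complex_re] at hre
    rw [← hre, ← integral_const_mul]
    refine setIntegral_congr_fun measurableSet_Ioi fun x hx => ?_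
    have e : Complex.exp (-((z : ℂ) * x)) = ((Real.exp (-(z * x)) : ℝ) : ℂ) := by push_cast; rfl
    rw [hP, zolDensity_eq hα1, e, Complex.re_ofReal_mul]; ring
  rw [hlhs]
  have hre := Complex.hasSum_re hs
  simp only [Complex.ofReal_re] at hre
  rw [← hre.tsum_eq, tsum_mul_left, mittagLeffler, hBγ, hγ]
  have hpi := Real.pi_ne_zero
  simp only [mul_assoc]
  field_simp
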